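/- arXiv:2408.11484 — 8 statements merged into one kernel-verified Lean document; each statement's English description precedes it below -/
import Mathlib

section
/- B. H. Neumann's theorem: if G is a group and there is a natural number n such that every conjugacy class of G has at most n elements, then the derived (commutator) subgroup G' of G is finite. -/
/-- If `g` has finitely many conjugates, then its centralizer has finite index. -/
theorem Subgroup.finiteIndex_centralizer_singleton_of_finite {G : Type*} [Group G] {g : G}
    (h : {x : G | IsConj g x}.Finite) : (Subgroup.centralizer {g}).FiniteIndex := by
  have horbit : MulAction.orbit (ConjAct G) g = {x : G | IsConj g x} := by
    ext x
    rw [ConjAct.mem_orbit_conjAct, Set.mem_ofPred_eq, isConj_comm]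
  have hindex := MulAction.index_stabilizer (ConjAct G) g
  rw [horbit, ConjAct.stabilizer_eq_centralizer] at hindex
  have hne : {x : G | IsConj g x}.ncard ≠ 0 :=
    (Set.ncard_pos h).2 ⟨g, IsConj.refl g⟩ |>.ne'
  exact ⟨fun h0 => hne (hindex.symm.trans h0)⟩

open scoped commutatorElement in
/-- If the conjugacy class of `a` is finite and has maximal size, then for every `c` in some
subgroup of finite index, all commutators `⁅c, y⁆` lie in a fixed finite set. -/
theorem exists_finiteIndex_forall_commutatorElement_mem {G : Type*} [Group G]
    (hfin : ∀ g : G, {x : G | IsConj g x}.Finite) {a : G}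
    (hmax : ∀ g : G, {x : G | IsConj g x}.ncard ≤ {x : G | IsConj a x}.ncard) :
    ∃ C : Subgroup G, C.FiniteIndex ∧ ∃ F : Set G, F.Finite ∧ ∀ c ∈ C, ∀ y : G, ⁅c, y⁆ ∈ F := by
  set A : Set G := {x : G | IsConj a x}
  have : Finite A := hfin a
  have hconj : ∀ x : A, ∃ b : G, b * a * b⁻¹ = x := fun x => isConj_iff.1 x.2
  choose b hb using hconj
  refine ⟨⨅ x : A, Subgroup.centralizer {b x}, Subgroup.finiteIndex_iInf fun x =>
      Subgroup.finiteIndex_centralizer_singleton_of_finite (hfin (b x)),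
    Set.image2 (fun u v => u⁻¹ * v) A A, (hfin a).image2 _ (hfin a), fun c hc y => ?_⟩
  have hcomm : ∀ x : A, b x * c = c * b x := fun x =>
    Subgroup.mem_centralizer_iff.1 (Subgroup.mem_iInf.1 hc x) (b x) rfl
  have hsub : (· * c) '' A ⊆ {x : G | IsConj (a * c) x} := by
    rintro _ ⟨x, hx, rfl⟩
    refine isConj_iff.2 ⟨b ⟨x, hx⟩, ?_⟩
    have hcomm' : c * (b ⟨x, hx⟩)⁻¹ = (b ⟨x, hx⟩)⁻¹ * c := by
      rw [mul_inv_eq_iff_eq_mul, mul_assoc, ← hcomm, inv_mul_cancel_left]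
    rw [mul_assoc, mul_assoc, hcomm', ← mul_assoc, ← mul_assoc, hb]
  have heq : (· * c) '' A = {x : G | IsConj (a * c) x} :=
    Set.eq_of_subset_of_ncard_le hsub
      ((hmax _).trans_eq (Set.ncard_image_of_injective A (mul_left_injective c)).symm)
      (hfin _)
  have hy : y * (a * c) * y⁻¹ ∈ (· * c) '' A := heq ▸ isConj_iff.2 ⟨y, rfl⟩
  obtain ⟨u, hu, huc⟩ := hy
  refine ⟨u, hu, y * a * y⁻¹, isConj_iff.2 ⟨y, rfl⟩, ?_⟩
  rw [eq_mul_inv_of_mul_eq huc, commutatorElement_def]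
  group

open scoped commutatorElement in
/-- If all conjugacy classes are finite and some conjugacy class has maximal size, then there are
only finitely many commutators. -/
theorem finite_commutatorSet_of_finite_conj {G : Type*} [Group G]
    (hfin : ∀ g : G, {x : G | IsConj g x}.Finite) {a : G}
    (hmax : ∀ g : G, {x : G | IsConj g x}.ncard ≤ {x : G | IsConj a x}.ncard) :
    (commutatorSet G).Finite := by
  obtain ⟨C, hC, F, hF, hCF⟩ := exists_finiteIndex_forall_commutatorElement_mem hfin hmax
  refine (Set.finite_iUnion fun q : G ⧸ C => hF.image2
    (fun f v => q.out * f * q.out⁻¹ * (q.out * v)) (hfin q.out⁻¹)).subset ?_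
  rintro _ ⟨x, y, rfl⟩
  refine Set.mem_iUnion.2 ⟨(x : G ⧸ C), ?_⟩
  set t : G := (x : G ⧸ C).out
  have hc : t⁻¹ * x ∈ C := QuotientGroup.eq.1 (QuotientGroup.out_eq' (x : G ⧸ C))
  refine ⟨⁅t⁻¹ * x, y⁆, hCF _ hc y, y * t⁻¹ * y⁻¹, isConj_iff.2 ⟨y, rfl⟩, ?_⟩
  simp only [commutatorElement_def]
  group

/-- B. H. Neumann's theorem: if every conjugacy class of a group `G` has at most `n`
elements, then the derived (commutator) subgroup of `G` is finite. -/
theorem neumann_bounded_classes {G : Type*} [Group G] (n : ℕ)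
    (h : ∀ g : G, {x : G | IsConj g x}.Finite ∧ {x : G | IsConj g x}.ncard ≤ n) :
    ((commutator G : Subgroup G) : Set G).Finite := by
  obtain ⟨a, ha⟩ := Nat.sSup_mem (s := Set.range fun g : G => {x : G | IsConj g x}.ncard)
    (Set.range_nonempty _) ⟨n, Set.forall_mem_range.2 fun g => (h g).2⟩
  have hmax : ∀ g : G, {x : G | IsConj g x}.ncard ≤ {x : G | IsConj a x}.ncard := fun g =>
    (le_csSup ⟨n, Set.forall_mem_range.2 fun g => (h g).2⟩ ⟨g, rfl⟩).trans_eq ha.symm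
  have : Finite (commutatorSet G) := finite_commutatorSet_of_finite_conj (fun g => (h g).1) hmax
  exact (inferInstance : Finite (commutator G))
end

section
/- Let G be a group, A a normal subgroup of G of finite index, and F a finite normal subgroup of A such that the quotient A/F is abelian. Then the derived subgroup A' of A is finite and is a normal subgroup of G, and the quotient group G/A' is abelian-by-finite, i.e. G/A' has an abelian normal subgroup of finite index (namely A/A'). -/
open scoped commutatorElement in
/-- A subgroup `A` whose quotient by (the trace of) `F` is commutative has `⁅A, A⁆ ≤ F`. -/
theorem Subgroup.commutator_le_of_quotient_comm {G : Type*} [Group G] (A F : Subgroup G)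
    [(F.subgroupOf A).Normal] (habel : ∀ x y : A ⧸ F.subgroupOf A, x * y = y * x) :
    ⁅A, A⁆ ≤ F := by
  rw [Subgroup.commutator_le]
  intro x hx y hy
  have h : ((⁅(⟨x, hx⟩ : A), ⟨y, hy⟩⁆ : A) : A ⧸ F.subgroupOf A) = 1 := by
    change QuotientGroup.mk' (F.subgroupOf A) _ = 1
    rw [map_commutatorElement, commutatorElement_eq_one_iff_mul_comm]
    exact habel _ _
  exact Subgroup.mem_subgroupOf.mp ((QuotientGroup.eq_one_iff _).mp h)


/-- If `A` is a normal subgroup of finite index of `G` and `F` is a finite normal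
subgroup of `A` with `A/F` abelian, then the derived subgroup `A' = ⁅A,A⁆` is finite
and normal in `G`, and `G/A'` has an abelian normal subgroup of finite index,
namely `A/A'`. -/
theorem finite_by_abelian_by_finite {G : Type*} [Group G] (A F : Subgroup G)
    [A.Normal] [A.FiniteIndex] (hFA : F ≤ A) [(F.subgroupOf A).Normal]
    (hF : (F : Set G).Finite)
    (habel : ∀ x y : A ⧸ F.subgroupOf A, x * y = y * x) :
    (((⁅A, A⁆ : Subgroup G) : Set G)).Finite ∧
    ∃ _hN : (⁅A, A⁆ : Subgroup G).Normal,
      haveI := _hN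
      ∃ B : Subgroup (G ⧸ (⁅A, A⁆ : Subgroup G)),
        B = A.map (QuotientGroup.mk' ⁅A, A⁆) ∧
        B.Normal ∧ B.FiniteIndex ∧ ∀ x ∈ B, ∀ y ∈ B, x * y = y * x := by
  refine ⟨hF.subset (Subgroup.commutator_le_of_quotient_comm A F habel), inferInstance, _, rfl,
    Subgroup.Normal.map inferInstance _ (QuotientGroup.mk'_surjective _), ?_, ?_⟩
  · have hdvd := A.index_map_dvd (QuotientGroup.mk'_surjective ⁅A, A⁆)
    exact ⟨ne_zero_of_dvd_ne_zero Subgroup.FiniteIndex.index_ne_zero hdvd⟩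
  · rintro _ ⟨x, hx, rfl⟩ _ ⟨y, hy, rfl⟩
    rw [← commutatorElement_eq_one_iff_mul_comm, ← map_commutatorElement]
    exact (QuotientGroup.eq_one_iff _).mpr (Subgroup.commutator_mem_commutator hx hy)
end

section
/- Every (finite-by-soluble)-by-finite group is soluble-by-finite, with derived length increasing by at most 1: if G is a group, A a normal subgroup of G of finite index, and F a finite normal subgroup of A such that A/F is solvable of derived length d, then G has a normal subgroup of finite index which is solvable of derived length at most d + 1. -/
/-- Every (finite-by-soluble)-by-finite group is soluble-by-finite, the derived length
increasing by at most 1: if `A` is a normal subgroup of finite index of `G` and `F` is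
a finite normal subgroup of `A` with `A/F` solvable of derived length (at most) `d`,
then `G` has a normal subgroup of finite index which is solvable of derived length at
most `d + 1`. -/
theorem finite_by_soluble_by_finite {G : Type*} [Group G] (A F : Subgroup G)
    [A.Normal] [A.FiniteIndex] (hFA : F ≤ A) [(F.subgroupOf A).Normal]
    (hF : (F : Set G).Finite) (d : ℕ)
    (hsol : derivedSeries (A ⧸ F.subgroupOf A) d = ⊥) :
    ∃ N : Subgroup G, N.Normal ∧ N.FiniteIndex ∧
      derivedSeries N (d + 1) = ⊥ := by
  have : Finite (F.subgroupOf A) :=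
    (hF.preimage Subtype.val_injective.injOn).to_subtype
  have : Finite (MulAut (F.subgroupOf A)) :=
    Finite.of_injective (fun e : MulAut (F.subgroupOf A) => e.toEquiv)
      MulEquiv.toEquiv_injective
  let C : Subgroup A := (MulAut.conjNormal (H := F.subgroupOf A)).ker
  have hC : C.FiniteIndex := Subgroup.finiteIndex_ker _
  have : (C.map A.subtype).FiniteIndex :=
    ⟨by
      rw [Subgroup.index_map_subtype]
      exact mul_ne_zero hC.index_ne_zero Subgroup.FiniteIndex.index_ne_zero⟩
  refine ⟨(C.map A.subtype).normalCore, inferInstance, inferInstance, ?_⟩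
  set N := (C.map A.subtype).normalCore
  have hNC : N ≤ C.map A.subtype := Subgroup.normalCore_le _
  let f : N →* A := Subgroup.inclusion (hNC.trans (Subgroup.map_subtype_le C))
  have hfC (x : N) : f x ∈ C := by
    obtain ⟨c, hc, hcx⟩ := hNC x.2
    rwa [show f x = c from Subtype.ext hcx.symm]
  have hfF (x : N) (hx : x ∈ derivedSeries N d) : f x ∈ F.subgroupOf A := by
    have h := map_derivedSeries_le_derivedSeries
      ((QuotientGroup.mk' (F.subgroupOf A)).comp f) d (Subgroup.mem_map_of_mem _ hx)
    rw [hsol, Subgroup.mem_bot] at h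
    exact (QuotientGroup.eq_one_iff _).mp h
  rw [derivedSeries_succ, Subgroup.commutator_eq_bot_iff_le_centralizer]
  intro x _
  rw [Subgroup.mem_centralizer_iff]
  intro y hy
  apply Subgroup.inclusion_injective (hNC.trans (Subgroup.map_subtype_le C))
  change f (y * x) = f (x * y)
  have h := congrArg Subtype.val
    (DFunLike.congr_fun (MonoidHom.mem_ker.mp (hfC x)) (⟨f y, hfF y hy⟩ : F.subgroupOf A))
  rw [MulAut.conjNormal_apply, MulAut.one_apply, mul_inv_eq_iff_eq_mul] at h
  rw [map_mul, map_mul, h]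
end

section
/- Semisimplicity passes to normal subgroups of finite index: let G be a group with no nontrivial abelian normal subgroup, and let N be a normal subgroup of G of finite index. Then N has no nontrivial abelian normal subgroup (where normality is meant in N). -/
open scoped Pointwise

/-- Conjugates of a subgroup normalized by a subgroup of finite index are finite in number. -/
theorem Subgroup.finite_range_conj_smul {G : Type*} [Group G] {N : Subgroup G} [N.FiniteIndex]
    {C : Subgroup G} (hC : ∀ n ∈ N, MulAut.conj n • C = C) :
    (Set.range fun g : G => MulAut.conj g • C).Finite := by
  refine (Set.finite_range fun q : G ⧸ N => MulAut.conj q.out • C).subset ?_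
  rintro _ ⟨g, rfl⟩
  obtain ⟨n, hn⟩ := QuotientGroup.mk_out_eq_mul N g
  exact ⟨(g : G ⧸ N), by simp only [hn, map_mul, mul_smul, hC n n.2]⟩

/-- If every element of `D` commutes with every conjugate of every element of `D`, then the
normal closure of `D` is commutative. -/
theorem Subgroup.commute_of_mem_normalClosure {G : Type*} [Group G] {D : Set G}
    (hD : ∀ x ∈ D, ∀ y ∈ D, ∀ g : G, Commute x (g * y * g⁻¹)) {x y : G}
    (hx : x ∈ Subgroup.normalClosure D) (hy : y ∈ Subgroup.normalClosure D) :
    Commute x y := by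
  have key : ∀ x ∈ Group.conjugatesOfSet D, ∀ y ∈ Group.conjugatesOfSet D, x * y = y * x := by
    intro x hx y hy
    obtain ⟨x, hxD, hx⟩ := Group.mem_conjugatesOfSet_iff.1 hx
    obtain ⟨y, hyD, hy⟩ := Group.mem_conjugatesOfSet_iff.1 hy
    obtain ⟨a, rfl⟩ := isConj_iff.1 hx
    obtain ⟨b, rfl⟩ := isConj_iff.1 hy
    have h := (Commute.conj_iff a).2 (hD x hxD y hyD (a⁻¹ * b))
    have e : a * (a⁻¹ * b * y * (a⁻¹ * b)⁻¹) * a⁻¹ = b * y * b⁻¹ := by group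
    rw [e] at h
    exact h
  have := Subgroup.isMulCommutative_closure key
  exact congrArg Subtype.val (mul_comm' (⟨x, hx⟩ : Subgroup.closure (Group.conjugatesOfSet D)) ⟨y, hy⟩)

/-- Semisimplicity passes to normal subgroups of finite index: if `G` has no
nontrivial abelian normal subgroup and `N` is a normal subgroup of `G` of finite
index, then `N` has no nontrivial abelian normal subgroup. -/
theorem semisimple_normal_finiteIndex {G : Type*} [Group G]
    (hG : ∀ A : Subgroup G, A.Normal → (∀ x ∈ A, ∀ y ∈ A, x * y = y * x) → A = ⊥)
    (N : Subgroup G) [N.Normal] [N.FiniteIndex] :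
    ∀ B : Subgroup N, B.Normal → (∀ x ∈ B, ∀ y ∈ B, x * y = y * x) → B = ⊥ := by
  intro B hB hcomm
  have hnorm : ∀ n ∈ N, MulAut.conj n • B.map N.subtype = B.map N.subtype := by
    have hle : ∀ n ∈ N, MulAut.conj n • B.map N.subtype ≤ B.map N.subtype := by
      rintro n hn _ ⟨_, ⟨b, hb, rfl⟩, rfl⟩
      exact ⟨⟨n, hn⟩ * b * ⟨n, hn⟩⁻¹, hB.conj_mem b hb _, rfl⟩
    refine fun n hn => (hle n hn).antisymm ?_
    rw [Subgroup.subset_pointwise_smul_iff, ← map_inv]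
    exact hle _ (inv_mem hn)
  have hT := Subgroup.finite_range_conj_smul hnorm
  set C := B.map N.subtype with hC
  set T := Set.range fun g : G => MulAut.conj g • C
  have hTN : ∀ A ∈ T, A ≤ N := by
    rintro _ ⟨g, rfl⟩ _ ⟨_, ⟨b, -, rfl⟩, rfl⟩
    exact Subgroup.Normal.conj_mem inferInstance _ b.2 g
  have hTcomm : ∀ A ∈ T, ∀ x ∈ A, ∀ y ∈ A, Commute x y := by
    rintro _ ⟨g, rfl⟩ _ ⟨_, ⟨b, hb, rfl⟩, rfl⟩ _ ⟨_, ⟨c, hc, rfl⟩, rfl⟩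
    exact (Commute.conj_iff g).2 (congrArg Subtype.val (hcomm b hb c hc))
  have hTnorm : ∀ A ∈ T, ∀ n ∈ N, ∀ x ∈ A, n * x * n⁻¹ ∈ A := by
    rintro _ ⟨g, rfl⟩ n hn x hx
    have h : MulAut.conj n • MulAut.conj g • C = MulAut.conj g • C := by
      have e : n * g = g * (g⁻¹ * n * g) := by group
      rw [← mul_smul, ← map_mul, e, map_mul, mul_smul, hnorm]
      simpa using Subgroup.Normal.conj_mem inferInstance n hn g⁻¹
    have := Subgroup.smul_mem_pointwise_smul x (MulAut.conj n) _ hx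
    rwa [h] at this
  by_contra hne
  have hCne : C ≠ ⊥ := by
    rwa [hC, Ne, Subgroup.map_eq_bot_iff_of_injective _ N.subtype_injective]
  have hfin : {S : Set (Subgroup G) | S ⊆ T ∧ S.Nonempty ∧ sInf S ≠ ⊥}.Finite :=
    hT.finite_subsets.subset fun S hS => hS.1
  obtain ⟨S, ⟨hST, ⟨A, hAS⟩, hSne⟩, hmax⟩ := hfin.exists_maximal
    ⟨{C}, Set.singleton_subset_iff.2 ⟨1, by simp⟩, Set.singleton_nonempty C, by simpa using hCne⟩
  have hD : ∀ x ∈ sInf S, ∀ y ∈ sInf S, ∀ g : G, Commute x (g * y * g⁻¹) := by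
    intro x hx y hy g
    rw [Subgroup.mem_sInf] at hx hy
    let S' := (fun A : Subgroup G => MulAut.conj g • A) '' S
    have hS'T : S' ⊆ T := by
      rintro _ ⟨_, hA, rfl⟩
      obtain ⟨h, rfl⟩ := hST hA
      exact ⟨g * h, by simp only [map_mul, mul_smul]⟩
    have hyS' : ∀ A ∈ S', g * y * g⁻¹ ∈ A := by
      rintro _ ⟨A, hA, rfl⟩
      exact Subgroup.smul_mem_pointwise_smul y (MulAut.conj g) A (hy A hA)
    have hxN : x ∈ N := hTN A (hST hAS) (hx A hAS)
    have hyN : g * y * g⁻¹ ∈ N :=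
      Subgroup.Normal.conj_mem inferInstance y (hTN A (hST hAS) (hy A hAS)) g
    by_cases hbot : sInf (S ∪ S') = ⊥
    · rw [← commutatorElement_eq_one_iff_commute, ← Subgroup.mem_bot, ← hbot, Subgroup.mem_sInf,
        commutatorElement_def]
      rintro E (hE | hE)
      · have := mul_mem (hx E hE) (hTnorm E (hST hE) _ hyN _ (inv_mem (hx E hE)))
        simpa only [mul_assoc] using this
      · exact mul_mem (hTnorm E (hS'T hE) _ hxN _ (hyS' E hE)) (inv_mem (hyS' E hE))
    · have hle : S ∪ S' ⊆ S := hmax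
        ⟨Set.union_subset hST hS'T, ⟨A, Or.inl hAS⟩, hbot⟩ Set.subset_union_left
      have hgA : MulAut.conj g • A ∈ S' := ⟨A, hAS, rfl⟩
      exact hTcomm _ (hS'T hgA) _ (hx _ (hle (Or.inr hgA))) _ (hyS' _ hgA)
  have hclosure := hG (Subgroup.normalClosure (sInf S : Subgroup G)) Subgroup.normalClosure_normal
    fun x hx y hy => Subgroup.commute_of_mem_normalClosure hD hx hy
  exact hSne (eq_bot_iff.2 (hclosure ▸ Subgroup.le_normalClosure))
end

section
/- Let N be a finite group, C a normal subgroup of N, and k an involution of N with k ∉ C. If C contains an involution, then there exists an involution ℓ ∈ C which commutes with k. -/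
/-- If `a` conjugates `r` to its inverse, then `a` commutes with every involution that is a
power of `r`. -/
theorem SemiconjBy.commute_pow_of_pow_sq_eq_one {G : Type*} [Group G] {a r : G}
    (h : SemiconjBy a r r⁻¹) {m : ℕ} (hm : (r ^ m) ^ 2 = 1) : Commute a (r ^ m) := by
  have h' := h.pow_right m
  rwa [inv_pow, inv_eq_of_mul_eq_one_left (a := r ^ m) (b := r ^ m) (by rw [← sq, hm])] at h'

/-- If `C` is a normal subgroup of a finite group `N`, `k` is an involution of `N`
with `k ∉ C`, and `C` contains an involution, then there is an involution `ℓ ∈ C`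
commuting with `k`. -/
theorem involution_in_normal_commuting {N : Type*} [Group N] [Finite N]
    (C : Subgroup N) [C.Normal] (k : N) (hk : orderOf k = 2) (hkC : k ∉ C)
    (hC : ∃ c ∈ C, orderOf c = 2) :
    ∃ ℓ ∈ C, orderOf ℓ = 2 ∧ ℓ * k = k * ℓ := by
  obtain ⟨c, hcC, hc⟩ := hC
  have hk2 : k * k = 1 := by rw [← sq, ← hk, pow_orderOf_eq_one]
  have hc2 : c * c = 1 := by rw [← sq, ← hc, pow_orderOf_eq_one]
  have hkinv : k⁻¹ = k := inv_eq_of_mul_eq_one_left hk2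
  have hcinv : c⁻¹ = c := inv_eq_of_mul_eq_one_left hc2
  have hmk : ((k * c : N) : N ⧸ C) = (k : N ⧸ C) := by
    rw [QuotientGroup.mk_mul, (QuotientGroup.eq_one_iff c).2 hcC, mul_one]
  have hqk2 : (k : N ⧸ C) ^ 2 = 1 := by
    rw [← QuotientGroup.mk_pow, sq, hk2, QuotientGroup.mk_one]
  have hqk : orderOf (k : N ⧸ C) = 2 :=
    orderOf_eq_prime hqk2 (fun h => hkC ((QuotientGroup.eq_one_iff k).1 h))
  have hdvd : 2 ∣ orderOf (k * c) := by
    rw [← hqk, ← hmk]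
    exact orderOf_map_dvd (QuotientGroup.mk' C) (k * c)
  obtain ⟨m, hm⟩ := hdvd
  have hpos : 0 < orderOf (k * c) := orderOf_pos _
  have hz2 : ((k * c) ^ m) ^ 2 = 1 := by rw [← pow_mul, mul_comm, ← hm, pow_orderOf_eq_one]
  have hz1 : (k * c) ^ m ≠ 1 := pow_ne_one_of_lt_orderOf (by omega) (by omega)
  have hkz : Commute k ((k * c) ^ m) := by
    refine SemiconjBy.commute_pow_of_pow_sq_eq_one ?_ hz2
    simp [SemiconjBy, ← mul_assoc, hk2, hkinv, hcinv]
    rw [mul_assoc, hk2, mul_one]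
  have hcz : Commute c ((k * c) ^ m) := by
    refine SemiconjBy.commute_pow_of_pow_sq_eq_one ?_ hz2
    simp [SemiconjBy, mul_assoc, hkinv, hcinv]
  have hmkz : (((k * c) ^ m : N) : N ⧸ C) = (k : N ⧸ C) ^ m := by
    rw [QuotientGroup.mk_pow, hmk]
  rcases Nat.even_or_odd' m with ⟨j, hj | hj⟩
  · refine ⟨(k * c) ^ m, ?_, orderOf_eq_prime hz2 hz1, hkz.symm.eq⟩
    rw [← QuotientGroup.eq_one_iff, hmkz, hj, pow_mul, hqk2, one_pow]
  · by_cases hzk : (k * c) ^ m = k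
    · rw [hzk] at hcz
      exact ⟨c, hcC, hc, hcz.eq⟩
    · refine ⟨(k * c) ^ m * k, ?_, orderOf_eq_prime ?_ ?_, ?_⟩
      · rw [← QuotientGroup.eq_one_iff, QuotientGroup.mk_mul, hmkz, ← pow_succ,
          show m + 1 = 2 * (j + 1) by omega, pow_mul, hqk2, one_pow]
      · rw [hkz.symm.mul_pow, hz2, sq, hk2, one_mul]
      · intro h
        exact hzk (by rw [eq_inv_of_mul_eq_one_left h, hkinv])
      · exact (hkz.symm.mul_left (Commute.refl k)).eq
end

section
/- In any finite group, two involutions are either conjugate or there is an involution commuting with both of them: if G is a finite group and i, j ∈ G are involutions, then either there exists g ∈ G with g⁻¹ig = j, or there exists an involution k ∈ G with ki = ik and kj = jk. -/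
/-- An involution inverts its product with any other involution. -/
theorem semiconjBy_mul_inv_of_involutions {G : Type*} [Group G] {i j : G}
    (hi : i * i = 1) (hj : j * j = 1) :
    SemiconjBy i (i * j) (i * j)⁻¹ ∧ SemiconjBy j (i * j) (i * j)⁻¹ := by
  have hi' : i⁻¹ = i := inv_eq_of_mul_eq_one_left hi
  have hj' : j⁻¹ = j := inv_eq_of_mul_eq_one_left hj
  simp only [SemiconjBy, mul_inv_rev, hi', hj']
  refine ⟨?_, (mul_assoc j i j).symm⟩
  rw [mul_assoc j i i, hi, ← mul_assoc, hi, one_mul, mul_one]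

/-- In a finite group, two involutions are either conjugate or there is an involution
commuting with both of them. -/
theorem involutions_conj_or_common_centralizer {G : Type*} [Group G] [Finite G]
    (i j : G) (hi : orderOf i = 2) (hj : orderOf j = 2) :
    (∃ g : G, g⁻¹ * i * g = j) ∨
    (∃ k : G, orderOf k = 2 ∧ k * i = i * k ∧ k * j = j * k) := by
  have hi2 : i * i = 1 := by rw [← sq, ← hi, pow_orderOf_eq_one]
  have hj2 : j * j = 1 := by rw [← sq, ← hj, pow_orderOf_eq_one]
  obtain ⟨hia, hja⟩ := semiconjBy_mul_inv_of_involutions hi2 hj2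
  have hpos : 0 < orderOf (i * j) := orderOf_pos _
  have hone : (i * j) ^ orderOf (i * j) = 1 := pow_orderOf_eq_one _
  obtain ⟨m, hm⟩ | ⟨m, hm⟩ := Nat.even_or_odd (orderOf (i * j))
  · right
    have hinv : (i * j)⁻¹ ^ m = (i * j) ^ m := by
      rw [inv_pow]
      exact inv_eq_of_mul_eq_one_left (by rw [← pow_add, ← hm, hone])
    have hik := hia.pow_right m
    have hjk := hja.pow_right m
    rw [hinv] at hik hjk
    refine ⟨(i * j) ^ m, ?_, hik.eq.symm, hjk.eq.symm⟩
    refine orderOf_eq_prime (by rw [← pow_mul, mul_two, ← hm, hone]) ?_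
    exact pow_ne_one_of_lt_orderOf (by omega) (by omega)
  · left
    refine ⟨(i * j) ^ (m + 1), ?_⟩
    have hik := (hia.pow_right (m + 1)).eq
    rw [inv_pow] at hik
    have hsum : (i * j) ^ (m + 1) * (i * j) ^ (m + 1) = i * j := by
      rw [← pow_add, show m + 1 + (m + 1) = (2 * m + 1) + 1 by ring, pow_succ, ← hm, hone, one_mul]
    rw [← hik, mul_assoc, hsum, ← mul_assoc, hi2, one_mul]
end

section
/- Let G be a group, Z a finite normal subgroup of G, x ∈ G, and S an infinite subset of G such that the commutator x s x⁻¹ s⁻¹ lies in Z for every s ∈ S. Then the centraliser C_G(x) is infinite. -/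
/-- If `Z` is a finite normal subgroup of `G`, `x ∈ G`, and `S` is an infinite subset
of `G` with `x * s * x⁻¹ * s⁻¹ ∈ Z` for every `s ∈ S`, then the centraliser `C_G(x)`
is infinite. -/
theorem centralizer_infinite_of_commutators_in_finite {G : Type*} [Group G]
    (Z : Subgroup G) [Z.Normal] (hZ : (Z : Set G).Finite) (x : G) (S : Set G)
    (hS : S.Infinite) (hcomm : ∀ s ∈ S, x * s * x⁻¹ * s⁻¹ ∈ Z) :
    ((Subgroup.centralizer {x} : Subgroup G) : Set G).Infinite := by
  intro hC
  refine hS (Set.Finite.of_finite_fibers (fun s => x * s * x⁻¹ * s⁻¹)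
    (hZ.subset (Set.image_subset_iff.mpr hcomm)) ?_)
  rintro _ ⟨t, -, rfl⟩
  refine (hC.image (t * ·)).subset ?_
  rintro s ⟨-, hs⟩
  refine ⟨t⁻¹ * s, ?_, mul_inv_cancel_left t s⟩
  have h_conj : s * x * s⁻¹ = t * x * t⁻¹ := by
    have h_eq : x * s * x⁻¹ * s⁻¹ = x * t * x⁻¹ * t⁻¹ := hs
    simpa [mul_assoc] using congrArg (fun g => g⁻¹ * x) h_eq
  rw [SetLike.mem_coe, Subgroup.mem_centralizer_singleton_iff]
  calc t⁻¹ * s * x = t⁻¹ * (s * x * s⁻¹) * s := by group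
    _ = x * (t⁻¹ * s) := by rw [h_conj]; group
end

section
/- Free action of a malnormal complement on the kernel: let G be a group, A a normal subgroup of G, and H a subgroup of G with A ∩ H = 1 and H ∩ H^g = 1 for every g ∈ G \ H. Then C_A(h) = 1 for every h ∈ H with h ≠ 1. If moreover G is finite and AH = G, then the order |H| divides |A| − 1. -/
/-- The conjugation action of a subgroup `H` on the nontrivial elements of a normal subgroup `A`. -/
@[reducible]
def conjActionOnNontrivial {G : Type*} [Group G] (A H : Subgroup G) [hA : A.Normal] :
    MulAction H ((A : Set G) \ {1} : Set G) where
  smul h a := ⟨h * a * (h : G)⁻¹, hA.conj_mem _ a.2.1 _, by simpa using a.2.2⟩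
  one_smul a := Subtype.ext (show ((1 : H) : G) * a * ((1 : H) : G)⁻¹ = a by simp)
  mul_smul h k a := Subtype.ext
    (show ((h * k : H) : G) * a * ((h * k : H) : G)⁻¹ = h * (k * a * (k : G)⁻¹) * (h : G)⁻¹ by
      simp [mul_assoc])

/-- If no nontrivial element of `H` centralizes a nontrivial element of the normal
subgroup `A`, then `|H|` divides `|A| - 1`. -/
theorem card_dvd_card_sub_one_of_centralizer_trivial {G : Type*} [Group G] (A H : Subgroup G)
    [A.Normal] (hfree : ∀ h ∈ H, h ≠ 1 → ∀ a ∈ A, a * h = h * a → a = 1) :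
    Nat.card H ∣ Nat.card A - 1 := by
  let := conjActionOnNontrivial A H
  have hstab (a : ((A : Set G) \ {1} : Set G)) : MulAction.stabilizer H a = ⊥ := by
    refine (Subgroup.eq_bot_iff_forall _).2 fun h hh => ?_
    have hconj : (h : G) * a * (h : G)⁻¹ = a := congrArg Subtype.val hh
    by_contra hne
    exact a.2.2 (hfree h h.2 (by simpa using hne) a a.2.1 (mul_inv_eq_iff_eq_mul.1 hconj).symm)
  have hcard : Nat.card ((A : Set G) \ {1} : Set G) = Nat.card A - 1 :=
    Set.ncard_sdiff_singleton_of_mem A.one_mem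
  rw [← hcard, Nat.card_congr (MulAction.selfEquivOrbitsQuotientProd hstab), Nat.card_prod]
  exact dvd_mul_left _ _

/-- Free action of a malnormal complement on the kernel: if `A` is a normal subgroup
of `G` and `H` a subgroup with `A ∩ H = 1` and `H ∩ H^g = 1` for all `g ∉ H`, then
`C_A(h) = 1` for every `1 ≠ h ∈ H`; and if moreover `G` is finite with `AH = G`,
then `|H|` divides `|A| - 1`. -/
theorem malnormal_complement_free_action {G : Type*} [Group G] (A H : Subgroup G)
    [A.Normal] (hAH1 : A ⊓ H = ⊥)
    (hmal : ∀ g : G, g ∉ H → ∀ x ∈ H, g * x * g⁻¹ ∈ H → x = 1) :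
    (∀ h ∈ H, h ≠ 1 → ∀ a ∈ A, a * h = h * a → a = 1) ∧
    (Finite G → (∀ g : G, ∃ a ∈ A, ∃ h ∈ H, g = a * h) →
      Nat.card H ∣ Nat.card A - 1) := by
  have hfree : ∀ h ∈ H, h ≠ 1 → ∀ a ∈ A, a * h = h * a → a = 1 := by
    intro h hh hne a ha hcomm
    have haH : a ∈ H := by
      by_contra haH
      exact hne (hmal a haH h hh (by rwa [hcomm, mul_inv_cancel_right]))
    exact Subgroup.mem_bot.1 (hAH1 ▸ Subgroup.mem_inf.2 ⟨ha, haH⟩)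
  exact ⟨hfree, fun _ _ => card_dvd_card_sub_one_of_centralizer_trivial A H hfree⟩
end
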